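/- Let M = U ×_f V be a warped product whose metric g is super generalized recurrent (SGK_n) with associated 1-forms (Π, Φ, Ψ, Θ). Then at every point x ∈ M at which the 1-form 2(κ̄ − (n−p) tr T)Φ + pΨ is nonzero (i.e. 2(κ̄ − (n−p) tr T)Φ_m + pΨ_m ≠ 0 at x for some m ∈ {1,…,n}), the fiber satisfies the Einstein metric condition: there exists a real number λ such that S̃_{αβ} = λ g̃_{αβ} at x for all α, β. -/

import Mathlib

noncomputable section

/-- Partial derivative of a scalar function along the `j`-th coordinate direction. -/
def pd {k : ℕ} (F : (Fin k → ℝ) → ℝ) (j : Fin k) (x : Fin k → ℝ) : ℝ :=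
  fderiv ℝ F x (Pi.single j 1)

/-- Christoffel symbols `Γ^i_{jl}` of a metric `h` with (pointwise) inverse `hinv`. -/
def Christoffel {k : ℕ} (h hinv : (Fin k → ℝ) → Fin k → Fin k → ℝ)
    (i j l : Fin k) (x : Fin k → ℝ) : ℝ :=
  (1 / 2) * ∑ r, hinv x i r *
    (pd (fun y => h y r l) j x + pd (fun y => h y j r) l x - pd (fun y => h y j l) r x)

/-- The (0,4) Riemann-Christoffel curvature tensor of `h`. -/
def Riem {k : ℕ} (h hinv : (Fin k → ℝ) → Fin k → Fin k → ℝ)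
    (x : Fin k → ℝ) (i j s l : Fin k) : ℝ :=
  ∑ r, h x i r *
    (pd (Christoffel h hinv r l j) s x - pd (Christoffel h hinv r s j) l x
      + (∑ t, Christoffel h hinv r s t x * Christoffel h hinv t l j x)
      - ∑ t, Christoffel h hinv r l t x * Christoffel h hinv t s j x)

/-- The Ricci tensor of `h`. -/
def Ric {k : ℕ} (h hinv : (Fin k → ℝ) → Fin k → Fin k → ℝ)
    (x : Fin k → ℝ) (j l : Fin k) : ℝ :=
  ∑ i, ∑ s, hinv x i s * Riem h hinv x i j s l

/-- The scalar curvature of `h`. -/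
def Scal {k : ℕ} (h hinv : (Fin k → ℝ) → Fin k → Fin k → ℝ) (x : Fin k → ℝ) : ℝ :=
  ∑ j, ∑ l, hinv x j l * Ric h hinv x j l

/-- Covariant derivative (w.r.t. the Levi-Civita connection of `h`) of a (0,4) tensor field. -/
def cov4 {k : ℕ} (h hinv : (Fin k → ℝ) → Fin k → Fin k → ℝ)
    (T : (Fin k → ℝ) → Fin k → Fin k → Fin k → Fin k → ℝ)
    (x : Fin k → ℝ) (i j s l m : Fin k) : ℝ :=
  pd (fun y => T y i j s l) m x
    - (∑ r, Christoffel h hinv r m i x * T x r j s l)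
    - (∑ r, Christoffel h hinv r m j x * T x i r s l)
    - (∑ r, Christoffel h hinv r m s x * T x i j r l)
    - ∑ r, Christoffel h hinv r m l x * T x i j s r

/-- Covariant derivative of a (0,2) tensor field. -/
def cov2 {k : ℕ} (h hinv : (Fin k → ℝ) → Fin k → Fin k → ℝ)
    (T : (Fin k → ℝ) → Fin k → Fin k → ℝ) (x : Fin k → ℝ) (i j m : Fin k) : ℝ :=
  pd (fun y => T y i j) m x
    - (∑ r, Christoffel h hinv r m i x * T x r j)
    - ∑ r, Christoffel h hinv r m j x * T x i r

/-- Kulkarni-Nomizu product of two (0,2) tensors. -/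
def KN {k : ℕ} (A E : (Fin k → ℝ) → Fin k → Fin k → ℝ)
    (x : Fin k → ℝ) (i j s l : Fin k) : ℝ :=
  A x i l * E x j s + A x j s * E x i l - A x i s * E x j l - A x j l * E x i s

/-- The Gaussian curvature tensor `G_{ijsl} = h_{il}h_{js} - h_{is}h_{jl}`. -/
def Gt {k : ℕ} (h : (Fin k → ℝ) → Fin k → Fin k → ℝ)
    (x : Fin k → ℝ) (i j s l : Fin k) : ℝ :=
  h x i l * h x j s - h x i s * h x j l

/-- The conformal (Weyl) curvature tensor of a `k`-dimensional metric `h`. -/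
def Weyl {k : ℕ} (h hinv : (Fin k → ℝ) → Fin k → Fin k → ℝ)
    (x : Fin k → ℝ) (i j s l : Fin k) : ℝ :=
  Riem h hinv x i j s l - (1 / ((k : ℝ) - 2)) * KN h (Ric h hinv) x i j s l
    + (Scal h hinv x / (2 * ((k : ℝ) - 1) * ((k : ℝ) - 2))) * KN h h x i j s l

/-- Recurrency condition at a point. -/
def Recur {k : ℕ} (h hinv : (Fin k → ℝ) → Fin k → Fin k → ℝ)
    (piF : (Fin k → ℝ) → Fin k → ℝ) (x : Fin k → ℝ) : Prop :=
  ∀ i j s l m, cov4 h hinv (Riem h hinv) x i j s l m = piF x m * Riem h hinv x i j s l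

/-- Hyper generalized recurrency condition at a point. -/
def HGK {k : ℕ} (h hinv : (Fin k → ℝ) → Fin k → Fin k → ℝ)
    (piF psiF : (Fin k → ℝ) → Fin k → ℝ) (x : Fin k → ℝ) : Prop :=
  ∀ i j s l m, cov4 h hinv (Riem h hinv) x i j s l m =
    piF x m * Riem h hinv x i j s l + psiF x m * KN h (Ric h hinv) x i j s l

/-- Weakly generalized recurrency condition at a point. -/
def WGK {k : ℕ} (h hinv : (Fin k → ℝ) → Fin k → Fin k → ℝ)
    (piF phiF : (Fin k → ℝ) → Fin k → ℝ) (x : Fin k → ℝ) : Prop :=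
  ∀ i j s l m, cov4 h hinv (Riem h hinv) x i j s l m =
    piF x m * Riem h hinv x i j s l
      + phiF x m * KN (Ric h hinv) (Ric h hinv) x i j s l

/-- Super generalized recurrency condition at a point. -/
def SGK {k : ℕ} (h hinv : (Fin k → ℝ) → Fin k → Fin k → ℝ)
    (piF phiF psiF thetaF : (Fin k → ℝ) → Fin k → ℝ) (x : Fin k → ℝ) : Prop :=
  ∀ i j s l m, cov4 h hinv (Riem h hinv) x i j s l m =
    piF x m * Riem h hinv x i j s l
      + phiF x m * KN (Ric h hinv) (Ric h hinv) x i j s l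
      + psiF x m * KN h (Ric h hinv) x i j s l
      + thetaF x m * KN h h x i j s l

/-- Base-point projection of a point of `M = U × V`. -/
def bpt {p q : ℕ} (z : Fin (p + q) → ℝ) : Fin p → ℝ := fun a => z (Fin.castAdd q a)

/-- Fiber-point projection of a point of `M = U × V`. -/
def fpt {p q : ℕ} (z : Fin (p + q) → ℝ) : Fin q → ℝ := fun a => z (Fin.natAdd p a)

/-- Block-diagonal combination of a base tensor `A` and a fiber tensor `B` scaled by `c`. -/
def wPair {p q : ℕ} (A : (Fin p → ℝ) → Fin p → Fin p → ℝ)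
    (B : (Fin q → ℝ) → Fin q → Fin q → ℝ) (c : (Fin p → ℝ) → ℝ)
    (z : Fin (p + q) → ℝ) (i j : Fin (p + q)) : ℝ :=
  Sum.elim
    (fun a => Sum.elim (fun b => A (bpt z) a b) (fun _ => (0 : ℝ)) (finSumFinEquiv.symm j))
    (fun a => Sum.elim (fun _ => (0 : ℝ)) (fun b => c (bpt z) * B (fpt z) a b)
      (finSumFinEquiv.symm j))
    (finSumFinEquiv.symm i)

/-- The warped product metric `g = ḡ ⊕ f g̃`. -/
def wMet {p q : ℕ} (gbar : (Fin p → ℝ) → Fin p → Fin p → ℝ)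
    (gtil : (Fin q → ℝ) → Fin q → Fin q → ℝ) (f : (Fin p → ℝ) → ℝ) :
    (Fin (p + q) → ℝ) → Fin (p + q) → Fin (p + q) → ℝ :=
  wPair gbar gtil f

/-- The inverse of the warped product metric. -/
def wMetInv {p q : ℕ} (gbinv : (Fin p → ℝ) → Fin p → Fin p → ℝ)
    (gtinv : (Fin q → ℝ) → Fin q → Fin q → ℝ) (f : (Fin p → ℝ) → ℝ) :
    (Fin (p + q) → ℝ) → Fin (p + q) → Fin (p + q) → ℝ :=
  wPair gbinv gtinv fun x => (f x)⁻¹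

/-- The set of points of `M = U × V` inside `ℝ^{p+q}`. -/
def Mset {p q : ℕ} (U : Set (Fin p → ℝ)) (V : Set (Fin q → ℝ)) : Set (Fin (p + q) → ℝ) :=
  {z | bpt z ∈ U ∧ fpt z ∈ V}

/-- The tensor `T_{ab} = -(1/(2f))(f_{a,b} - (1/(2f)) f_a f_b)`. -/
def Tten {p : ℕ} (gbar gbinv : (Fin p → ℝ) → Fin p → Fin p → ℝ) (f : (Fin p → ℝ) → ℝ)
    (x : Fin p → ℝ) (a b : Fin p) : ℝ :=
  -(1 / (2 * f x)) *
    ((pd (fun y => pd f a y) b x - ∑ c, Christoffel gbar gbinv c b a x * pd f c x)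
      - (1 / (2 * f x)) * pd f a x * pd f b x)

/-- `tr T = ḡ^{ab} T_{ab}`. -/
def trT {p : ℕ} (gbar gbinv : (Fin p → ℝ) → Fin p → Fin p → ℝ) (f : (Fin p → ℝ) → ℝ)
    (x : Fin p → ℝ) : ℝ :=
  ∑ a, ∑ b, gbinv x a b * Tten gbar gbinv f x a b

/-- `P = (1/(4f²)) ḡ^{ab} f_a f_b`. -/
def Pw {p : ℕ} (gbinv : (Fin p → ℝ) → Fin p → Fin p → ℝ) (f : (Fin p → ℝ) → ℝ)
    (x : Fin p → ℝ) : ℝ :=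
  (1 / (4 * f x ^ 2)) * ∑ a, ∑ b, gbinv x a b * pd f a x * pd f b x

/-- `Q = f((n-p-1)P - tr T)`, with `n - p = q`. -/
def Qw {p : ℕ} (q : ℕ) (gbar gbinv : (Fin p → ℝ) → Fin p → Fin p → ℝ)
    (f : (Fin p → ℝ) → ℝ) (x : Fin p → ℝ) : ℝ :=
  f x * (((q : ℝ) - 1) * Pw gbinv f x - trT gbar gbinv f x)

open Filter Topology

/-- A smooth symmetric nondegenerate metric on an open set, with its pointwise inverse. -/
structure IsSmoothMetricOn {k : ℕ} (h hinv : (Fin k → ℝ) → Fin k → Fin k → ℝ)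
    (W : Set (Fin k → ℝ)) : Prop where
  isOpen : IsOpen W
  smooth : ∀ a b, ContDiffOn ℝ (⊤ : ℕ∞) (fun x => h x a b) W
  symm : ∀ x ∈ W, ∀ a b, h x a b = h x b a
  mul_inv : ∀ x ∈ W, ∀ a b, (∑ c, h x a c * hinv x c b) = if a = b then (1 : ℝ) else 0

section PartialDerivative

variable {k : ℕ} {F G : (Fin k → ℝ) → ℝ} {x : Fin k → ℝ}

lemma pd_congr (h : F =ᶠ[𝓝 x] G) (j : Fin k) : pd F j x = pd G j x := by
  rw [pd, pd, h.fderiv_eq]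

@[simp] lemma pd_const (c : ℝ) (j : Fin k) : pd (fun _ => c) j x = 0 := by
  simp [pd]

lemma ContDiffAt.pd (hF : ContDiffAt ℝ (⊤ : ℕ∞) F x) (j : Fin k) :
    ContDiffAt ℝ (⊤ : ℕ∞) (pd F j) x :=
  (hF.fderiv_right (m := (⊤ : ℕ∞)) (by simp)).clm_apply contDiffAt_const

lemma contDiffAt_det {M : (Fin k → ℝ) → Matrix (Fin k) (Fin k) ℝ}
    (hM : ∀ i j, ContDiffAt ℝ (⊤ : ℕ∞) (fun y => M y i j) x) :
    ContDiffAt ℝ (⊤ : ℕ∞) (fun y => (M y).det) x := by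
  simp_rw [Matrix.det_apply']
  exact ContDiffAt.sum fun σ _ => contDiffAt_const.mul (contDiffAt_prod fun i _ => hM _ _)

end PartialDerivative

section Projections

variable {p q : ℕ} {z : Fin (p + q) → ℝ}

/-- The base projection as a continuous linear map. -/
def bptL (p q : ℕ) : (Fin (p + q) → ℝ) →L[ℝ] (Fin p → ℝ) :=
  ContinuousLinearMap.pi fun a => ContinuousLinearMap.proj (Fin.castAdd q a)

/-- The fiber projection as a continuous linear map. -/
def fptL (p q : ℕ) : (Fin (p + q) → ℝ) →L[ℝ] (Fin q → ℝ) :=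
  ContinuousLinearMap.pi fun a => ContinuousLinearMap.proj (Fin.natAdd p a)

lemma hasFDerivAt_bpt : HasFDerivAt (bpt : (Fin (p + q) → ℝ) → Fin p → ℝ) (bptL p q) z :=
  (bptL p q).hasFDerivAt

lemma hasFDerivAt_fpt : HasFDerivAt (fpt : (Fin (p + q) → ℝ) → Fin q → ℝ) (fptL p q) z :=
  (fptL p q).hasFDerivAt

lemma bptL_single_castAdd (a : Fin p) :
    bptL p q (Pi.single (Fin.castAdd q a) 1) = Pi.single a 1 := by
  ext b
  simp [bptL, Pi.single_apply]

lemma bptL_single_natAdd (α : Fin q) : bptL p q (Pi.single (Fin.natAdd p α) 1) = 0 := by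
  ext b
  simp [bptL, Pi.single_apply, Fin.ext_iff]
  omega

lemma fptL_single_castAdd (a : Fin p) : fptL p q (Pi.single (Fin.castAdd q a) 1) = 0 := by
  ext b
  simp [fptL, Pi.single_apply, Fin.ext_iff]
  omega

lemma fptL_single_natAdd (α : Fin q) :
    fptL p q (Pi.single (Fin.natAdd p α) 1) = Pi.single α 1 := by
  ext b
  simp [fptL, Pi.single_apply]

variable {A : (Fin p → ℝ) → ℝ} {B : (Fin q → ℝ) → ℝ}

lemma pd_mul_castAdd (hA : DifferentiableAt ℝ A (bpt z)) (hB : DifferentiableAt ℝ B (fpt z))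
    (a : Fin p) :
    pd (fun y => A (bpt y) * B (fpt y)) (Fin.castAdd q a) z = pd A a (bpt z) * B (fpt z) := by
  have h := (hA.hasFDerivAt.comp z hasFDerivAt_bpt).mul (hB.hasFDerivAt.comp z hasFDerivAt_fpt)
  rw [pd, HasFDerivAt.fderiv (f := fun y => A (bpt y) * B (fpt y)) h]
  simp [bptL_single_castAdd, fptL_single_castAdd, pd, mul_comm]

lemma pd_mul_natAdd (hA : DifferentiableAt ℝ A (bpt z)) (hB : DifferentiableAt ℝ B (fpt z))
    (α : Fin q) :
    pd (fun y => A (bpt y) * B (fpt y)) (Fin.natAdd p α) z = A (bpt z) * pd B α (fpt z) := by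
  have h := (hA.hasFDerivAt.comp z hasFDerivAt_bpt).mul (hB.hasFDerivAt.comp z hasFDerivAt_fpt)
  rw [pd, HasFDerivAt.fderiv (f := fun y => A (bpt y) * B (fpt y)) h]
  simp [bptL_single_natAdd, fptL_single_natAdd, pd]

lemma pd_bpt_castAdd (hA : DifferentiableAt ℝ A (bpt z)) (a : Fin p) :
    pd (fun y => A (bpt y)) (Fin.castAdd q a) z = pd A a (bpt z) := by
  simpa using pd_mul_castAdd (B := fun _ => 1) hA (by fun_prop) a

lemma pd_bpt_natAdd (hA : DifferentiableAt ℝ A (bpt z)) (α : Fin q) :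
    pd (fun y => A (bpt y)) (Fin.natAdd p α) z = 0 := by
  simpa using pd_mul_natAdd (B := fun _ => 1) hA (by fun_prop) α

lemma pd_fpt_natAdd (hB : DifferentiableAt ℝ B (fpt z)) (α : Fin q) :
    pd (fun y => B (fpt y)) (Fin.natAdd p α) z = pd B α (fpt z) := by
  simpa using pd_mul_natAdd (A := fun _ => 1) (by fun_prop) hB α

lemma isOpen_Mset {U : Set (Fin p → ℝ)} {V : Set (Fin q → ℝ)} (hU : IsOpen U) (hV : IsOpen V) :
    IsOpen (Mset U V) :=
  (hU.preimage (bptL p q).continuous).inter (hV.preimage (fptL p q).continuous)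

end Projections

section BlockComponents

variable {p q : ℕ} (A : (Fin p → ℝ) → Fin p → Fin p → ℝ) (B : (Fin q → ℝ) → Fin q → Fin q → ℝ)
  (c : (Fin p → ℝ) → ℝ) (z : Fin (p + q) → ℝ)

@[simp] lemma wPair_base (a b : Fin p) :
    wPair A B c z (Fin.castAdd q a) (Fin.castAdd q b) = A (bpt z) a b := by
  simp [wPair]

@[simp] lemma wPair_fiber (α β : Fin q) :
    wPair A B c z (Fin.natAdd p α) (Fin.natAdd p β) = c (bpt z) * B (fpt z) α β := by
  simp [wPair]

@[simp] lemma wPair_base_fiber (a : Fin p) (β : Fin q) :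
    wPair A B c z (Fin.castAdd q a) (Fin.natAdd p β) = 0 := by
  simp [wPair]

@[simp] lemma wPair_fiber_base (α : Fin q) (b : Fin p) :
    wPair A B c z (Fin.natAdd p α) (Fin.castAdd q b) = 0 := by
  simp [wPair]

lemma wMet_base (a b : Fin p) :
    wMet A B c z (Fin.castAdd q a) (Fin.castAdd q b) = A (bpt z) a b :=
  wPair_base ..

lemma wMet_fiber (α β : Fin q) :
    wMet A B c z (Fin.natAdd p α) (Fin.natAdd p β) = c (bpt z) * B (fpt z) α β :=
  wPair_fiber ..

lemma wMet_base_fiber (a : Fin p) (β : Fin q) :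
    wMet A B c z (Fin.castAdd q a) (Fin.natAdd p β) = 0 :=
  wPair_base_fiber ..

lemma wMet_fiber_base (α : Fin q) (b : Fin p) :
    wMet A B c z (Fin.natAdd p α) (Fin.castAdd q b) = 0 :=
  wPair_fiber_base ..

lemma wMetInv_base (a b : Fin p) :
    wMetInv A B c z (Fin.castAdd q a) (Fin.castAdd q b) = A (bpt z) a b :=
  wPair_base ..

lemma wMetInv_fiber (α β : Fin q) :
    wMetInv A B c z (Fin.natAdd p α) (Fin.natAdd p β) = (c (bpt z))⁻¹ * B (fpt z) α β :=
  wPair_fiber ..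

lemma wMetInv_base_fiber (a : Fin p) (β : Fin q) :
    wMetInv A B c z (Fin.castAdd q a) (Fin.natAdd p β) = 0 :=
  wPair_base_fiber ..

lemma wMetInv_fiber_base (α : Fin q) (b : Fin p) :
    wMetInv A B c z (Fin.natAdd p α) (Fin.castAdd q b) = 0 :=
  wPair_fiber_base ..

end BlockComponents

namespace IsSmoothMetricOn

variable {k : ℕ} {h hinv : (Fin k → ℝ) → Fin k → Fin k → ℝ} {W : Set (Fin k → ℝ)}
  (H : IsSmoothMetricOn h hinv W) {x : Fin k → ℝ}
include H

lemma contDiffAt (hx : x ∈ W) (a b : Fin k) : ContDiffAt ℝ (⊤ : ℕ∞) (fun y => h y a b) x :=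
  (H.smooth a b).contDiffAt (H.isOpen.mem_nhds hx)

lemma inv_mul (hx : x ∈ W) (a b : Fin k) :
    (∑ c, hinv x a c * h x c b) = if a = b then (1 : ℝ) else 0 := by
  have hm : (Matrix.of (h x)) * (Matrix.of (hinv x)) = 1 := by
    ext i j
    simpa [Matrix.mul_apply, Matrix.one_apply] using H.mul_inv x hx i j
  have hm' : (Matrix.of (hinv x)) * (Matrix.of (h x)) = 1 := mul_eq_one_comm.mp hm
  simpa [Matrix.mul_apply, Matrix.one_apply] using congrFun (congrFun hm' a) b

lemma trace_inv_mul (hx : x ∈ W) : (∑ a, ∑ b, hinv x a b * h x a b) = k := by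
  calc (∑ a, ∑ b, hinv x a b * h x a b) = ∑ a, ∑ b, hinv x a b * h x b a := by
        simp_rw [H.symm x hx]
    _ = k := by simp [H.inv_mul hx]

lemma sum_mul_inv_mul (hx : x ∈ W) (b d : Fin k) :
    (∑ a, ∑ c, hinv x a c * (h x a d * h x c b)) = h x b d := by
  calc (∑ a, ∑ c, hinv x a c * (h x a d * h x c b))
      = ∑ a, h x a d * ∑ c, hinv x a c * h x c b := by
        refine Finset.sum_congr rfl fun a _ => ?_
        rw [Finset.mul_sum]
        exact Finset.sum_congr rfl fun c _ => by ring
    _ = h x b d := by simp [H.inv_mul hx]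

lemma contDiffAt_inv (hx : x ∈ W) (a b : Fin k) :
    ContDiffAt ℝ (⊤ : ℕ∞) (fun y => hinv y a b) x := by
  have hmul : ∀ y ∈ W, Matrix.of (h y) * Matrix.of (hinv y) = 1 := fun y hy => by
    ext i j
    simpa [Matrix.mul_apply, Matrix.one_apply] using H.mul_inv y hy i j
  have hdet : (Matrix.of (h x)).det ≠ 0 := by
    intro h0
    simpa [h0] using congrArg Matrix.det (hmul x hx)
  have heq : (fun y => hinv y a b) =ᶠ[𝓝 x]
      fun y => (Matrix.of (h y)).det⁻¹ * (Matrix.of (h y)).adjugate a b := by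
    filter_upwards [H.isOpen.mem_nhds hx] with y hy
    have := congrFun (congrFun (Matrix.inv_eq_right_inv (hmul y hy)) a) b
    simpa [Matrix.inv_def] using this.symm
  refine ContDiffAt.congr_of_eventuallyEq (ContDiffAt.mul ?_ ?_) heq
  · exact (contDiffAt_det fun i j => H.contDiffAt hx i j).inv hdet
  · simp_rw [Matrix.adjugate_apply]
    refine contDiffAt_det fun i j => ?_
    by_cases hi : i = b
    · subst hi
      simpa using contDiffAt_const
    · simpa [Matrix.updateRow_ne hi] using H.contDiffAt hx i j

lemma contDiffAt_christoffel (hx : x ∈ W) (i j l : Fin k) :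
    ContDiffAt ℝ (⊤ : ℕ∞) (Christoffel h hinv i j l) x :=
  contDiffAt_const.mul <| ContDiffAt.sum fun r _ => (H.contDiffAt_inv hx i r).mul
    ((((H.contDiffAt hx r l).pd j).add ((H.contDiffAt hx j r).pd l)).sub
      ((H.contDiffAt hx j l).pd r))

lemma pd_symm (hx : x ∈ W) (a b j : Fin k) :
    pd (fun y => h y a b) j x = pd (fun y => h y b a) j x :=
  pd_congr (by filter_upwards [H.isOpen.mem_nhds hx] with y hy using H.symm y hy a b) j

lemma christoffel_symm (hx : x ∈ W) (i j l : Fin k) :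
    Christoffel h hinv i j l x = Christoffel h hinv i l j x := by
  unfold Christoffel
  congr 1
  refine Finset.sum_congr rfl fun r _ => ?_
  rw [H.pd_symm hx r l, H.pd_symm hx j r, H.pd_symm hx j l]
  ring

lemma sum_mul_christoffel (hx : x ∈ W) (a j l : Fin k) :
    (∑ i, h x a i * Christoffel h hinv i j l x) = (1 / 2) *
      (pd (fun y => h y a l) j x + pd (fun y => h y j a) l x - pd (fun y => h y j l) a x) := by
  have hc : ∀ v : Fin k → ℝ, (∑ i, h x a i * ((1 / 2) * ∑ r, hinv x i r * v r))
      = (1 / 2) * v a := fun v => by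
    calc (∑ i, h x a i * ((1 / 2) * ∑ r, hinv x i r * v r))
        = (1 / 2) * ∑ r, (∑ i, h x a i * hinv x i r) * v r := by
          simp_rw [Finset.mul_sum, Finset.sum_mul]
          rw [Finset.sum_comm]
          simp_rw [Finset.mul_sum]
          exact Finset.sum_congr rfl fun r _ => Finset.sum_congr rfl fun i _ => by ring
      _ = (1 / 2) * v a := by simp [H.mul_inv x hx]
  exact hc _

lemma ric_of_constant_curvature (hx : x ∈ W) {K : ℝ}
    (hK : ∀ i j s l, Riem h hinv x i j s l = K * (h x i s * h x l j - h x i l * h x s j))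
    (j l : Fin k) : Ric h hinv x j l = K * (k - 1) * h x j l := by
  calc Ric h hinv x j l
      = K * (h x l j * (∑ i, ∑ s, hinv x i s * h x i s)
          - ∑ i, ∑ s, hinv x i s * (h x i l * h x s j)) := by
        simp only [Ric, hK, Finset.mul_sum, ← Finset.sum_sub_distrib]
        exact Finset.sum_congr rfl fun i _ => Finset.sum_congr rfl fun s _ => by ring
    _ = K * (k - 1) * h x j l := by
        rw [H.trace_inv_mul hx, H.sum_mul_inv_mul hx, H.symm x hx l j]
        ring

end IsSmoothMetricOn

/-- The data of a warped product `U ×_f V`. -/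
structure IsWarpedProduct {p q : ℕ} (gbar gbinv : (Fin p → ℝ) → Fin p → Fin p → ℝ)
    (gtil gtinv : (Fin q → ℝ) → Fin q → Fin q → ℝ) (f : (Fin p → ℝ) → ℝ)
    (U : Set (Fin p → ℝ)) (V : Set (Fin q → ℝ)) : Prop where
  base : IsSmoothMetricOn gbar gbinv U
  fiber : IsSmoothMetricOn gtil gtinv V
  warp_smooth : ContDiffOn ℝ (⊤ : ℕ∞) f U
  warp_pos : ∀ x ∈ U, 0 < f x

/-- The vector `-½ grad f`, so that `Γ^a_{βγ}` is its `a`-component times `g̃_{βγ}`. -/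
def warpNormal {p : ℕ} (gbinv : (Fin p → ℝ) → Fin p → Fin p → ℝ) (f : (Fin p → ℝ) → ℝ)
    (a : Fin p) (x : Fin p → ℝ) : ℝ :=
  -(1 / 2) * ∑ b, gbinv x a b * pd f b x

/-- The `1`-form `df / (2f)`. -/
def warpRate {p : ℕ} (f : (Fin p → ℝ) → ℝ) (a : Fin p) (x : Fin p → ℝ) : ℝ :=
  (2 * f x)⁻¹ * pd f a x

namespace IsWarpedProduct

variable {p q : ℕ} {gbar gbinv : (Fin p → ℝ) → Fin p → Fin p → ℝ}
  {gtil gtinv : (Fin q → ℝ) → Fin q → Fin q → ℝ} {f : (Fin p → ℝ) → ℝ}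
  {U : Set (Fin p → ℝ)} {V : Set (Fin q → ℝ)}
  (H : IsWarpedProduct gbar gbinv gtil gtinv f U V) {z : Fin (p + q) → ℝ}

local notation "Γ" => Christoffel (wMet gbar gtil f) (wMetInv gbinv gtinv f)
local notation "Rw" => Riem (wMet gbar gtil f) (wMetInv gbinv gtinv f)
local notation "Sw" => Ric (wMet gbar gtil f) (wMetInv gbinv gtinv f)
local notation "ιb" => Fin.castAdd q
local notation "ιf" => Fin.natAdd p

include H

lemma mem_nhds (hz : z ∈ Mset U V) : ∀ᶠ y in 𝓝 z, y ∈ Mset U V :=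
  (isOpen_Mset H.base.isOpen H.fiber.isOpen).mem_nhds hz

lemma contDiffAt_warp {x : Fin p → ℝ} (hx : x ∈ U) : ContDiffAt ℝ (⊤ : ℕ∞) f x :=
  H.warp_smooth.contDiffAt (H.base.isOpen.mem_nhds hx)

lemma contDiffAt_warpNormal {x : Fin p → ℝ} (hx : x ∈ U) (a : Fin p) :
    ContDiffAt ℝ (⊤ : ℕ∞) (warpNormal gbinv f a) x :=
  contDiffAt_const.mul <| ContDiffAt.sum fun b _ =>
    (H.base.contDiffAt_inv hx a b).mul ((H.contDiffAt_warp hx).pd b)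

lemma contDiffAt_warpRate {x : Fin p → ℝ} (hx : x ∈ U) (a : Fin p) :
    ContDiffAt ℝ (⊤ : ℕ∞) (warpRate f a) x :=
  ((contDiffAt_const.mul (H.contDiffAt_warp hx)).inv
    (mul_ne_zero two_ne_zero (H.warp_pos x hx).ne')).mul ((H.contDiffAt_warp hx).pd a)

section Metric

variable (hz : z ∈ Mset U V)
include hz

lemma pd_metric_base_base (a b c : Fin p) :
    pd (fun y => wMet gbar gtil f y (ιb a) (ιb b)) (ιb c) z
      = pd (fun x => gbar x a b) c (bpt z) := by
  simp only [wMet_base]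
  exact pd_bpt_castAdd ((H.base.contDiffAt hz.1 a b).differentiableAt (by simp)) c

lemma pd_metric_base_fiber (a b : Fin p) (γ : Fin q) :
    pd (fun y => wMet gbar gtil f y (ιb a) (ιb b)) (ιf γ) z = 0 := by
  simp only [wMet_base]
  exact pd_bpt_natAdd ((H.base.contDiffAt hz.1 a b).differentiableAt (by simp)) γ

lemma pd_metric_fiber_base (α β : Fin q) (c : Fin p) :
    pd (fun y => wMet gbar gtil f y (ιf α) (ιf β)) (ιb c) z
      = pd f c (bpt z) * gtil (fpt z) α β := by
  simp only [wMet_fiber]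
  exact pd_mul_castAdd (B := fun y => gtil y α β)
    ((H.contDiffAt_warp hz.1).differentiableAt (by simp))
    ((H.fiber.contDiffAt hz.2 α β).differentiableAt (by simp)) c

lemma pd_metric_fiber_fiber (α β γ : Fin q) :
    pd (fun y => wMet gbar gtil f y (ιf α) (ιf β)) (ιf γ) z
      = f (bpt z) * pd (fun x => gtil x α β) γ (fpt z) := by
  simp only [wMet_fiber]
  exact pd_mul_natAdd (B := fun y => gtil y α β)
    ((H.contDiffAt_warp hz.1).differentiableAt (by simp))
    ((H.fiber.contDiffAt hz.2 α β).differentiableAt (by simp)) γ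

omit H hz in
lemma pd_metric_cross (a : Fin p) (β : Fin q) (j : Fin (p + q)) :
    pd (fun y => wMet gbar gtil f y (ιb a) (ιf β)) j z = 0 := by
  simp [wMet]

omit H hz in
lemma pd_metric_cross' (α : Fin q) (b : Fin p) (j : Fin (p + q)) :
    pd (fun y => wMet gbar gtil f y (ιf α) (ιb b)) j z = 0 := by
  simp [wMet]

lemma christoffel_base_base_base (a b c : Fin p) :
    Γ (ιb a) (ιb b) (ιb c) z = Christoffel gbar gbinv a b c (bpt z) := by
  simp [Christoffel, Fin.sum_univ_add, wMetInv, H.pd_metric_base_base hz]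

lemma christoffel_base_base_fiber (a b : Fin p) (γ : Fin q) :
    Γ (ιb a) (ιb b) (ιf γ) z = 0 := by
  simp [Christoffel, Fin.sum_univ_add, wMetInv, pd_metric_cross, H.pd_metric_base_fiber hz]

lemma christoffel_base_fiber_base (a c : Fin p) (β : Fin q) :
    Γ (ιb a) (ιf β) (ιb c) z = 0 := by
  simp [Christoffel, Fin.sum_univ_add, wMetInv, pd_metric_cross', H.pd_metric_base_fiber hz]

lemma christoffel_base_fiber_fiber (a : Fin p) (β γ : Fin q) :
    Γ (ιb a) (ιf β) (ιf γ) z = warpNormal gbinv f a (bpt z) * gtil (fpt z) β γ := by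
  simp only [Christoffel, Fin.sum_univ_add, wMetInv, pd_metric_cross, pd_metric_cross',
    wPair_base, wPair_base_fiber, H.pd_metric_fiber_base hz, warpNormal]
  simp [Finset.sum_mul, Finset.mul_sum]
  exact Finset.sum_congr rfl fun r _ => by ring

lemma christoffel_fiber_base_base (α : Fin q) (b c : Fin p) :
    Γ (ιf α) (ιb b) (ιb c) z = 0 := by
  simp [Christoffel, Fin.sum_univ_add, wMetInv, pd_metric_cross, pd_metric_cross',
    H.pd_metric_base_fiber hz]

lemma christoffel_fiber_base_fiber (α γ : Fin q) (b : Fin p) :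
    Γ (ιf α) (ιb b) (ιf γ) z = warpRate f b (bpt z) * if α = γ then 1 else 0 := by
  rw [← H.fiber.inv_mul hz.2]
  simp [Christoffel, Fin.sum_univ_add, wMetInv, pd_metric_cross,
    H.pd_metric_fiber_base hz, warpRate, Finset.mul_sum]
  refine Finset.sum_congr rfl fun r _ => by ring

lemma christoffel_fiber_fiber_base (α β : Fin q) (c : Fin p) :
    Γ (ιf α) (ιf β) (ιb c) z = warpRate f c (bpt z) * if α = β then 1 else 0 := by
  rw [← H.fiber.inv_mul hz.2]
  simp [Christoffel, Fin.sum_univ_add, wMetInv, pd_metric_cross',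
    H.pd_metric_fiber_base hz, warpRate, Finset.mul_sum]
  refine Finset.sum_congr rfl fun r _ => by rw [H.fiber.symm _ hz.2 r β]; ring

lemma christoffel_fiber_fiber_fiber (α β γ : Fin q) :
    Γ (ιf α) (ιf β) (ιf γ) z = Christoffel gtil gtinv α β γ (fpt z) := by
  have hf0 := (H.warp_pos _ hz.1).ne'
  simp [Christoffel, Fin.sum_univ_add, wMetInv, H.pd_metric_fiber_fiber hz]
  refine Finset.sum_congr rfl fun r _ => by field_simp

end Metric

section ChristoffelDerivatives

variable (hz : z ∈ Mset U V)
include hz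

lemma pd_christoffel_base_base_base_base (a b c d : Fin p) :
    pd (Γ (ιb a) (ιb b) (ιb c)) (ιb d) z = pd (Christoffel gbar gbinv a b c) d (bpt z) := by
  rw [pd_congr ((H.mem_nhds hz).mono fun y hy => H.christoffel_base_base_base hy a b c)]
  exact pd_bpt_castAdd ((H.base.contDiffAt_christoffel hz.1 a b c).differentiableAt (by simp)) d

lemma pd_christoffel_base_base_base_fiber (a b c : Fin p) (δ : Fin q) :
    pd (Γ (ιb a) (ιb b) (ιb c)) (ιf δ) z = 0 := by
  rw [pd_congr ((H.mem_nhds hz).mono fun y hy => H.christoffel_base_base_base hy a b c)]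
  exact pd_bpt_natAdd ((H.base.contDiffAt_christoffel hz.1 a b c).differentiableAt (by simp)) δ

lemma pd_christoffel_base_base_fiber (a b : Fin p) (γ : Fin q) (j : Fin (p + q)) :
    pd (Γ (ιb a) (ιb b) (ιf γ)) j z = 0 := by
  rw [pd_congr ((H.mem_nhds hz).mono fun y hy => H.christoffel_base_base_fiber hy a b γ), pd_const]

lemma pd_christoffel_base_fiber_base (a c : Fin p) (β : Fin q) (j : Fin (p + q)) :
    pd (Γ (ιb a) (ιf β) (ιb c)) j z = 0 := by
  rw [pd_congr ((H.mem_nhds hz).mono fun y hy => H.christoffel_base_fiber_base hy a c β), pd_const]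

lemma pd_christoffel_fiber_base_base (α : Fin q) (b c : Fin p) (j : Fin (p + q)) :
    pd (Γ (ιf α) (ιb b) (ιb c)) j z = 0 := by
  rw [pd_congr ((H.mem_nhds hz).mono fun y hy => H.christoffel_fiber_base_base hy α b c), pd_const]

lemma pd_christoffel_base_fiber_fiber_base (a d : Fin p) (β γ : Fin q) :
    pd (Γ (ιb a) (ιf β) (ιf γ)) (ιb d) z
      = pd (warpNormal gbinv f a) d (bpt z) * gtil (fpt z) β γ := by
  rw [pd_congr ((H.mem_nhds hz).mono fun y hy => H.christoffel_base_fiber_fiber hy a β γ)]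
  exact pd_mul_castAdd (B := fun y => gtil y β γ)
    ((H.contDiffAt_warpNormal hz.1 a).differentiableAt (by simp))
    ((H.fiber.contDiffAt hz.2 β γ).differentiableAt (by simp)) d

lemma pd_christoffel_base_fiber_fiber_fiber (a : Fin p) (β γ δ : Fin q) :
    pd (Γ (ιb a) (ιf β) (ιf γ)) (ιf δ) z
      = warpNormal gbinv f a (bpt z) * pd (fun y => gtil y β γ) δ (fpt z) := by
  rw [pd_congr ((H.mem_nhds hz).mono fun y hy => H.christoffel_base_fiber_fiber hy a β γ)]
  exact pd_mul_natAdd (B := fun y => gtil y β γ)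
    ((H.contDiffAt_warpNormal hz.1 a).differentiableAt (by simp))
    ((H.fiber.contDiffAt hz.2 β γ).differentiableAt (by simp)) δ

lemma pd_christoffel_fiber_fiber_base_base (α β : Fin q) (c d : Fin p) :
    pd (Γ (ιf α) (ιf β) (ιb c)) (ιb d) z
      = pd (warpRate f c) d (bpt z) * if α = β then 1 else 0 := by
  rw [pd_congr ((H.mem_nhds hz).mono fun y hy => H.christoffel_fiber_fiber_base hy α β c)]
  exact pd_mul_castAdd (B := fun _ => if α = β then 1 else 0)
    ((H.contDiffAt_warpRate hz.1 c).differentiableAt (by simp)) (by fun_prop) d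

lemma pd_christoffel_fiber_fiber_base_fiber (α β δ : Fin q) (c : Fin p) :
    pd (Γ (ιf α) (ιf β) (ιb c)) (ιf δ) z = 0 := by
  rw [pd_congr ((H.mem_nhds hz).mono fun y hy => H.christoffel_fiber_fiber_base hy α β c)]
  refine (pd_mul_natAdd (B := fun _ => if α = β then 1 else 0)
    ((H.contDiffAt_warpRate hz.1 c).differentiableAt (by simp)) (by fun_prop) δ).trans ?_
  simp

lemma pd_christoffel_fiber_fiber_fiber_fiber (α β γ δ : Fin q) :
    pd (Γ (ιf α) (ιf β) (ιf γ)) (ιf δ) z = pd (Christoffel gtil gtinv α β γ) δ (fpt z) := by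
  rw [pd_congr ((H.mem_nhds hz).mono fun y hy => H.christoffel_fiber_fiber_fiber hy α β γ)]
  exact pd_fpt_natAdd ((H.fiber.contDiffAt_christoffel hz.2 α β γ).differentiableAt (by simp)) δ

end ChristoffelDerivatives

section Curvature

variable (hz : z ∈ Mset U V)
include hz

lemma riem_base (a b c d : Fin p) :
    Rw z (ιb a) (ιb b) (ιb c) (ιb d) = Riem gbar gbinv (bpt z) a b c d := by
  simp [Riem, Fin.sum_univ_add, wMet_base, wMet_base_fiber,
    H.pd_christoffel_base_base_base_base hz,
    H.christoffel_base_base_base hz, H.christoffel_base_base_fiber hz]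

lemma riem_base_base_base_fiber (a b c : Fin p) (δ : Fin q) :
    Rw z (ιb a) (ιb b) (ιb c) (ιf δ) = 0 := by
  simp [Riem, Fin.sum_univ_add, wMet_base, wMet_base_fiber,
    H.pd_christoffel_base_base_base_fiber hz,
    H.pd_christoffel_base_fiber_base hz, H.christoffel_base_fiber_base hz,
    H.christoffel_base_base_fiber hz, H.christoffel_fiber_base_base hz]

lemma riem_base_base_fiber_fiber (a b : Fin p) (γ δ : Fin q) :
    Rw z (ιb a) (ιb b) (ιf γ) (ιf δ) = 0 := by
  simp [Riem, Fin.sum_univ_add, wMet_base, wMet_base_fiber,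
    H.pd_christoffel_base_fiber_base hz,
    H.christoffel_base_fiber_base hz, H.christoffel_base_fiber_fiber hz,
    H.christoffel_fiber_fiber_base hz, H.fiber.symm _ hz.2 γ δ]

lemma riem_base_fiber_base_fiber (a c : Fin p) (β δ : Fin q) :
    Rw z (ιb a) (ιf β) (ιb c) (ιf δ) =
      (∑ e, gbar (bpt z) a e * (pd (warpNormal gbinv f e) c (bpt z)
        + (∑ d, Christoffel gbar gbinv e c d (bpt z) * warpNormal gbinv f d (bpt z))
        - warpNormal gbinv f e (bpt z) * warpRate f c (bpt z))) * gtil (fpt z) δ β := by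
  simp [Riem, Fin.sum_univ_add, wMet_base, wMet_base_fiber,
    H.pd_christoffel_base_fiber_fiber_base hz,
    H.pd_christoffel_base_base_fiber hz,
    H.christoffel_base_base_fiber hz,
    H.christoffel_base_base_base hz, H.christoffel_base_fiber_fiber hz,
    H.christoffel_fiber_base_fiber hz, Finset.sum_mul]
  refine Finset.sum_congr rfl fun e _ => ?_
  simp_rw [← mul_assoc, ← Finset.sum_mul]
  ring

lemma riem_fiber_base_fiber_base (a b : Fin p) (γ δ : Fin q) :
    Rw z (ιf γ) (ιb a) (ιf δ) (ιb b) =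
      f (bpt z) * (- pd (warpRate f a) b (bpt z)
        + (∑ d, warpRate f d (bpt z) * Christoffel gbar gbinv d b a (bpt z))
        - warpRate f b (bpt z) * warpRate f a (bpt z)) * gtil (fpt z) γ δ := by
  simp [Riem, Fin.sum_univ_add, wMet_fiber, wMet_fiber_base,
    H.pd_christoffel_fiber_fiber_base_base hz,
    H.pd_christoffel_fiber_base_base hz, H.christoffel_fiber_base_base hz,
    H.christoffel_base_base_base hz, H.christoffel_base_fiber_base hz,
    H.christoffel_fiber_fiber_base hz, H.christoffel_fiber_base_fiber hz]
  simp [mul_add, mul_sub, Finset.sum_add_distrib]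
  ring

lemma riem_fiber_base_fiber_fiber (a : Fin p) (β γ δ : Fin q) :
    Rw z (ιf β) (ιb a) (ιf γ) (ιf δ) = 0 := by
  simp [Riem, Fin.sum_univ_add, wMet_fiber, wMet_fiber_base,
    H.pd_christoffel_fiber_fiber_base_fiber hz,
    H.christoffel_fiber_fiber_base hz, H.christoffel_base_fiber_base hz,
    H.christoffel_fiber_fiber_fiber hz, H.fiber.christoffel_symm hz.2 _ γ δ]

lemma riem_base_fiber_fiber_fiber (a : Fin p) (β γ δ : Fin q) :
    Rw z (ιb a) (ιf β) (ιf γ) (ιf δ) = 0 := by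
  simp [Riem, Fin.sum_univ_add, wMet_base, wMet_base_fiber,
    H.pd_christoffel_base_fiber_fiber_fiber hz,
    H.christoffel_base_fiber_fiber hz, H.christoffel_base_fiber_base hz,
    H.christoffel_fiber_fiber_fiber hz, mul_assoc, ← Finset.mul_sum,
    H.fiber.sum_mul_christoffel hz.2]
  refine Finset.sum_eq_zero fun e _ => ?_
  rw [H.fiber.pd_symm hz.2 γ β, H.fiber.pd_symm hz.2 δ γ, H.fiber.pd_symm hz.2 δ β]
  ring

lemma riem_fiber (α β γ δ : Fin q) :
    Rw z (ιf α) (ιf β) (ιf γ) (ιf δ) = f (bpt z) * Riem gtil gtinv (fpt z) α β γ δ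
      + f (bpt z) * (∑ d, warpRate f d (bpt z) * warpNormal gbinv f d (bpt z)) *
        (gtil (fpt z) α γ * gtil (fpt z) δ β - gtil (fpt z) α δ * gtil (fpt z) γ β) := by
  simp [Riem, Fin.sum_univ_add, wMet_fiber, wMet_fiber_base,
    H.pd_christoffel_fiber_fiber_fiber_fiber hz,
    H.christoffel_base_fiber_fiber hz, H.christoffel_fiber_fiber_base hz,
    H.christoffel_fiber_fiber_fiber hz]
  simp_rw [← mul_assoc (warpRate f _ _), ← Finset.sum_mul]
  generalize (∑ d, warpRate f d (bpt z) * warpNormal gbinv f d (bpt z)) = K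
  simp [mul_add, mul_sub, Finset.sum_add_distrib, mul_assoc, ← Finset.mul_sum]
  ring

end Curvature

omit H in
lemma riem_swap {k : ℕ} {h hinv : (Fin k → ℝ) → Fin k → Fin k → ℝ} {x : Fin k → ℝ}
    (i j s l : Fin k) : Riem h hinv x i j s l = -Riem h hinv x i j l s := by
  simp only [Riem, ← Finset.sum_neg_distrib]
  exact Finset.sum_congr rfl fun r _ => by ring

omit H in
lemma ric_eq (j l : Fin (p + q)) : Sw z j l =
    (∑ a, ∑ b, gbinv (bpt z) a b * Rw z (ιb a) j (ιb b) l)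
      + ∑ α, ∑ β, (f (bpt z))⁻¹ * gtinv (fpt z) α β * Rw z (ιf α) j (ιf β) l := by
  simp [Ric, Fin.sum_univ_add, wMetInv_base, wMetInv_fiber, wMetInv_base_fiber,
    wMetInv_fiber_base]

section NonconstantWarping

variable (hz : z ∈ Mset U V)
include hz

lemma ric_base_fiber (a : Fin p) (δ : Fin q) : Sw z (ιb a) (ιf δ) = 0 := by
  simp [ric_eq, H.riem_base_base_base_fiber hz,
    H.riem_fiber_base_fiber_fiber hz]

lemma exists_cov_riem_base_fiber_fiber_fiber (a : Fin p) : ∃ w : ℝ, ∀ β γ δ ε : Fin q,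
    cov4 (wMet gbar gtil f) (wMetInv gbinv gtinv f) Rw z (ιb a) (ιf β) (ιf γ) (ιf δ) (ιf ε)
      = -(warpRate f a (bpt z) * Rw z (ιf ε) (ιf β) (ιf γ) (ιf δ))
        - w * (gtil (fpt z) ε γ * gtil (fpt z) δ β - gtil (fpt z) ε δ * gtil (fpt z) γ β) := by
  obtain ⟨X, hX⟩ : ∃ X : Fin p → ℝ, ∀ c β δ,
      Rw z (ιb a) (ιf β) (ιb c) (ιf δ) = X c * gtil (fpt z) δ β :=
    ⟨_, fun c β δ => H.riem_base_fiber_base_fiber hz a c β δ⟩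
  refine ⟨∑ c, warpNormal gbinv f c (bpt z) * X c, fun β γ δ ε => ?_⟩
  have hpd : pd (fun y => Rw y (ιb a) (ιf β) (ιf γ) (ιf δ)) (ιf ε) z = 0 := by
    rw [pd_congr ((H.mem_nhds hz).mono fun y hy => H.riem_base_fiber_fiber_fiber hy a β γ δ),
      pd_const]
  have hX' : ∀ c β δ, Rw z (ιb a) (ιf β) (ιf δ) (ιb c) = -(X c * gtil (fpt z) δ β) :=
    fun c β δ => by rw [riem_swap, hX]
  simp [cov4, hpd, Fin.sum_univ_add, H.christoffel_base_fiber_base hz,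
    H.christoffel_fiber_fiber_base hz, H.christoffel_base_fiber_fiber hz,
    H.riem_base_base_fiber_fiber hz, H.riem_base_fiber_fiber_fiber hz, hX, hX']
  rw [mul_sub, Finset.sum_mul, Finset.sum_mul, ← sub_add]
  congr 1
  · congr 1
    exact Finset.sum_congr rfl fun c _ => by ring
  · exact Finset.sum_congr rfl fun c _ => by ring

lemma exists_ric_fiber_eq_smul_of_warpRate_ne_zero {piF phiF psiF thetaF}
    (hsgk : SGK (wMet gbar gtil f) (wMetInv gbinv gtinv f) piF phiF psiF thetaF z)
    {a : Fin p} (ha : pd f a (bpt z) ≠ 0) :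
    ∃ lam : ℝ, ∀ α β, Ric gtil gtinv (fpt z) α β = lam * gtil (fpt z) α β := by
  have hf0 := (H.warp_pos _ hz.1).ne'
  have hu : warpRate f a (bpt z) ≠ 0 :=
    mul_ne_zero (inv_ne_zero (mul_ne_zero two_ne_zero hf0)) ha
  obtain ⟨w, hw⟩ := H.exists_cov_riem_base_fiber_fiber_fiber hz a
  set k := ∑ d, warpRate f d (bpt z) * warpNormal gbinv f d (bpt z) with hk
  refine ⟨_, H.fiber.ric_of_constant_curvature (K := -(w / (warpRate f a (bpt z) * f (bpt z)) + k))
    hz.2 fun ε β γ δ => ?_⟩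
  have h0 := hsgk (ιb a) (ιf β) (ιf γ) (ιf δ) (ιf ε)
  rw [hw, H.riem_base_fiber_fiber_fiber hz, H.riem_fiber hz, ← hk] at h0
  simp only [KN, H.ric_base_fiber hz, wMet_base_fiber] at h0
  field_simp
  linear_combination -h0

end NonconstantWarping

section ConstantWarping

variable (hc : ∀ x ∈ U, ∀ a, pd f a x = 0)
include hc

omit H in
lemma warpRate_eq_zero {x : Fin p → ℝ} (hx : x ∈ U) (a : Fin p) : warpRate f a x = 0 := by
  simp [warpRate, hc x hx]

omit H in
lemma warpNormal_eq_zero {x : Fin p → ℝ} (hx : x ∈ U) (a : Fin p) :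
    warpNormal gbinv f a x = 0 := by
  simp [warpNormal, hc x hx]

lemma trT_eq_zero {x : Fin p → ℝ} (hx : x ∈ U) : trT gbar gbinv f x = 0 := by
  have hpd : ∀ a b, pd (pd f a) b x = 0 := fun a b => by
    rw [pd_congr (G := fun _ => 0)
      ((H.base.isOpen.eventually_mem hx).mono fun y hy => hc y hy a), pd_const]
  simp [trT, Tten, hc x hx, hpd]

variable (hz : z ∈ Mset U V)
include hz

lemma riem_base_fiber_base_fiber_eq_zero (a c : Fin p) (β δ : Fin q) :
    Rw z (ιb a) (ιf β) (ιb c) (ιf δ) = 0 := by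
  have hpd : ∀ e, pd (warpNormal gbinv f e) c (bpt z) = 0 := fun e => by
    rw [pd_congr (G := fun _ => 0)
      ((H.base.isOpen.eventually_mem hz.1).mono fun y hy => warpNormal_eq_zero hc hy e), pd_const]
  simp [H.riem_base_fiber_base_fiber hz, hpd, warpNormal_eq_zero hc hz.1]

lemma riem_fiber_base_fiber_base_eq_zero (a b : Fin p) (γ δ : Fin q) :
    Rw z (ιf γ) (ιb a) (ιf δ) (ιb b) = 0 := by
  have hpd : pd (warpRate f a) b (bpt z) = 0 := by
    rw [pd_congr (G := fun _ => 0)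
      ((H.base.isOpen.eventually_mem hz.1).mono fun y hy => warpRate_eq_zero hc hy a), pd_const]
  simp [H.riem_fiber_base_fiber_base hz, hpd, warpRate_eq_zero hc hz.1]

lemma ric_base (a b : Fin p) : Sw z (ιb a) (ιb b) = Ric gbar gbinv (bpt z) a b := by
  rw [ric_eq, Ric]
  simp [H.riem_base hz,
    H.riem_fiber_base_fiber_base_eq_zero hc hz]

lemma ric_fiber (α β : Fin q) : Sw z (ιf α) (ιf β) = Ric gtil gtinv (fpt z) α β := by
  have hf0 := (H.warp_pos _ hz.1).ne'
  rw [ric_eq, Ric]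
  simp [H.riem_fiber hz,
    H.riem_base_fiber_base_fiber_eq_zero hc hz, warpRate_eq_zero hc hz.1]
  exact Finset.sum_congr rfl fun γ _ => Finset.sum_congr rfl fun δ _ => by field_simp

lemma cov_riem_base_fiber_base_fiber_eq_zero (a b : Fin p) (α β : Fin q) (m : Fin (p + q)) :
    cov4 (wMet gbar gtil f) (wMetInv gbinv gtinv f) Rw z (ιb a) (ιf α) (ιb b) (ιf β) m = 0 := by
  have hpd : pd (fun y => Rw y (ιb a) (ιf α) (ιb b) (ιf β)) m z = 0 := by
    rw [pd_congr ((H.mem_nhds hz).mono fun y hy =>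
      H.riem_base_fiber_base_fiber_eq_zero hc hy a b α β), pd_const]
  induction m using Fin.addCases
  · simp [cov4, hpd, Fin.sum_univ_add, H.riem_base_fiber_base_fiber_eq_zero hc hz,
      H.christoffel_fiber_base_base hz, H.christoffel_base_base_fiber hz]
  · simp [cov4, hpd, Fin.sum_univ_add, H.riem_base_fiber_base_fiber_eq_zero hc hz,
      H.christoffel_fiber_fiber_base hz, H.christoffel_base_fiber_fiber hz,
      warpRate_eq_zero hc hz.1, warpNormal_eq_zero hc hz.1]

lemma exists_ric_fiber_eq_smul_of_warp_constant {piF phiF psiF thetaF} {m : Fin (p + q)}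
    (hsgk : SGK (wMet gbar gtil f) (wMetInv gbinv gtinv f) piF phiF psiF thetaF z)
    (hm : 2 * Scal gbar gbinv (bpt z) * phiF z m + p * psiF z m ≠ 0) :
    ∃ lam : ℝ, ∀ α β, Ric gtil gtinv (fpt z) α β = lam * gtil (fpt z) α β := by
  refine ⟨-(psiF z m * Scal gbar gbinv (bpt z) + 2 * thetaF z m * p) * f (bpt z) /
    (2 * Scal gbar gbinv (bpt z) * phiF z m + p * psiF z m), fun α β => ?_⟩
  set S := Ric gtil gtinv (fpt z) α β with hS
  set G := f (bpt z) * gtil (fpt z) α β with hG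
  have hab : ∀ a b, Ric gbar gbinv (bpt z) a b * (2 * phiF z m * S + psiF z m * G)
      + gbar (bpt z) a b * (psiF z m * S + 2 * thetaF z m * G) = 0 := fun a b => by
    have h0 := hsgk (ιb a) (ιf α) (ιb b) (ιf β) m
    rw [H.cov_riem_base_fiber_base_fiber_eq_zero hc hz,
      H.riem_base_fiber_base_fiber_eq_zero hc hz] at h0
    simp only [KN, H.ric_base_fiber hz, H.ric_base hc hz, H.ric_fiber hc hz, wMet_base, wMet_fiber,
      wMet_base_fiber] at h0
    linear_combination h0
  have htr : Scal gbar gbinv (bpt z) * (2 * phiF z m * S + psiF z m * G)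
      + p * (psiF z m * S + 2 * thetaF z m * G) = 0 := by
    rw [← H.base.trace_inv_mul hz.1, Scal]
    simp_rw [Finset.sum_mul, ← Finset.sum_add_distrib]
    refine Finset.sum_eq_zero fun a _ => Finset.sum_eq_zero fun b _ => ?_
    linear_combination gbinv (bpt z) a b * hab a b
  rw [div_mul_eq_mul_div, eq_div_iff hm]
  linear_combination htr

end ConstantWarping

end IsWarpedProduct

/-- Corollary 4.1(v): the fiber of a warped product SGK manifold satisfies the Einstein
metric condition wherever the 1-form 2(κ̄ - (n-p) tr T)Φ + pΨ is nonzero. -/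
theorem fiber_of_warped_SGK_is_Einstein
    {p q : ℕ} (hp : 1 ≤ p) (hq : 1 ≤ q)
    (U : Set (Fin p → ℝ)) (V : Set (Fin q → ℝ))
    (hU : IsOpen U) (hV : IsOpen V)
    (gbar gbinv : (Fin p → ℝ) → Fin p → Fin p → ℝ)
    (gtil gtinv : (Fin q → ℝ) → Fin q → Fin q → ℝ)
    (f : (Fin p → ℝ) → ℝ)
    (hgb : ∀ a b, ContDiffOn ℝ (⊤ : ℕ∞) (fun x => gbar x a b) U)
    (hgbs : ∀ x ∈ U, ∀ a b, gbar x a b = gbar x b a)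
    (hgbi : ∀ x ∈ U, ∀ a b, (∑ c, gbar x a c * gbinv x c b) = if a = b then (1 : ℝ) else 0)
    (hgt : ∀ a b, ContDiffOn ℝ (⊤ : ℕ∞) (fun y => gtil y a b) V)
    (hgts : ∀ y ∈ V, ∀ a b, gtil y a b = gtil y b a)
    (hgti : ∀ y ∈ V, ∀ a b, (∑ c, gtil y a c * gtinv y c b) = if a = b then (1 : ℝ) else 0)
    (hf : ContDiffOn ℝ (⊤ : ℕ∞) f U)
    (hfpos : ∀ x ∈ U, 0 < f x)
    (piF phiF psiF thetaF : (Fin (p + q) → ℝ) → Fin (p + q) → ℝ)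
    (hpiF : ∀ m, ContDiffOn ℝ (⊤ : ℕ∞) (fun z => piF z m) (Mset U V))
    (hphiF : ∀ m, ContDiffOn ℝ (⊤ : ℕ∞) (fun z => phiF z m) (Mset U V))
    (hpsiF : ∀ m, ContDiffOn ℝ (⊤ : ℕ∞) (fun z => psiF z m) (Mset U V))
    (hthetaF : ∀ m, ContDiffOn ℝ (⊤ : ℕ∞) (fun z => thetaF z m) (Mset U V))
    (hsgk : ∀ z ∈ Mset U V, SGK (wMet gbar gtil f) (wMetInv gbinv gtinv f) piF phiF psiF thetaF z) :
    ∀ z ∈ Mset U V,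
      (∃ m : Fin (p + q),
        2 * (Scal gbar gbinv (bpt z) - (q : ℝ) * trT gbar gbinv f (bpt z)) * phiF z m
          + (p : ℝ) * psiF z m ≠ 0) →
      ∃ lam : ℝ, ∀ α β : Fin q, Ric gtil gtinv (fpt z) α β = lam * gtil (fpt z) α β := by
  intro z hz hm
  have H : IsWarpedProduct gbar gbinv gtil gtinv f U V :=
    ⟨⟨hU, hgb, hgbs, hgbi⟩, ⟨hV, hgt, hgts, hgti⟩, hf, hfpos⟩
  by_cases hc : ∀ x ∈ U, ∀ a, pd f a x = 0
  · obtain ⟨m, hm⟩ := hm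
    rw [H.trT_eq_zero hc hz.1, mul_zero, sub_zero] at hm
    exact H.exists_ric_fiber_eq_smul_of_warp_constant hc hz (hsgk z hz) hm
  · push Not at hc
    obtain ⟨x, hx, a, ha⟩ := hc
    obtain ⟨w, hwb, hwf⟩ : ∃ w : Fin (p + q) → ℝ, bpt w = x ∧ fpt w = fpt z :=
      ⟨Fin.append x (fpt z), by ext; simp [bpt], by ext; simp [fpt]⟩
    have hw : w ∈ Mset U V := ⟨hwb ▸ hx, hwf ▸ hz.2⟩
    rw [← hwf]
    exact H.exists_ric_fiber_eq_smul_of_warpRate_ne_zero hw (hsgk w hw) (hwb.symm ▸ ha)
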